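/- arXiv:2605.29469 — 3 statements merged into one kernel-verified Lean document; each statement's English description precedes it below -/
import Mathlib

section
/- Let β ∈ (0,1). For every s ≥ 0 the Mittag-Leffler function satisfies the two-sided bound 1/(1 + Γ(1−β)·s) ≤ E_β(−s) ≤ 1/(1 + s/Γ(1+β)). In particular 0 < E_β(−s) ≤ 1 for all s ≥ 0. -/
open Real MeasureTheory

/-- The Mittag-Leffler function `E_β(s) = ∑_{k=0}^∞ s^k / Γ(1 + βk)`. -/
noncomputable def mittagLeffler (β s : ℝ) : ℝ :=
  ∑' k : ℕ, s ^ k / Real.Gamma (1 + β * k)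

/-- The coefficients `c` define a power series with infinite radius of convergence. -/
def EntireCoeff (c : ℕ → ℝ) : Prop :=
  ∀ R : ℝ, 0 ≤ R → Summable fun k => |c k| * R ^ k

theorem rpow_mul_exp_neg_le_Gamma {A x : ℝ} (hA : 0 < A) (hx : 0 ≤ x) :
    A ^ x * Real.exp (-A) ≤ Real.Gamma (x + 1) := by
  have hint := Real.GammaIntegral_convergent (s := x + 1) (by linarith)
  have hsub : Set.Ioi A ⊆ Set.Ioi 0 := Set.Ioi_subset_Ioi hA.le
  rw [Real.Gamma_eq_integral (by linarith), ← integral_exp_neg_Ioi, ← integral_const_mul]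
  calc ∫ t in Set.Ioi A, A ^ x * Real.exp (-t)
      ≤ ∫ t in Set.Ioi A, Real.exp (-t) * t ^ (x + 1 - 1) := by
        refine setIntegral_mono_on ((integrableOn_exp_neg_Ioi A).const_mul _)
          (hint.mono_set hsub) measurableSet_Ioi fun t ht => ?_
        rw [mul_comm, add_sub_cancel_right]
        gcongr
        exact (Set.mem_Ioi.1 ht).le
    _ ≤ _ := setIntegral_mono_set hint
        (by
          filter_upwards [self_mem_ae_restrict measurableSet_Ioi] with t ht
          have := Set.mem_Ioi.1 ht
          positivity) hsub.eventuallyLE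

theorem entireCoeff_inv_Gamma {β : ℝ} (hβ : 0 < β) :
    EntireCoeff fun k => (-1) ^ k / Real.Gamma (1 + β * k) := by
  intro R hR
  set A : ℝ := (2 * R + 1) ^ (1 / β) with hA
  have hA0 : 0 < A := by positivity
  have hAβ : A ^ β = 2 * R + 1 := by
    rw [hA, ← Real.rpow_mul (by positivity), one_div_mul_cancel hβ.ne', Real.rpow_one]
  refine Summable.of_nonneg_of_le (fun k => by positivity) (fun k => ?_)
    ((summable_geometric_of_lt_one (r := 1 / 2) (by norm_num) (by norm_num)).mul_left
      (Real.exp A))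
  have h := rpow_mul_exp_neg_le_Gamma hA0 (x := β * k) (by positivity)
  rw [Real.rpow_mul hA0.le, Real.rpow_natCast, hAβ, add_comm (β * (k : ℝ))] at h
  have hG : 0 < Real.Gamma (1 + β * k) := Real.Gamma_pos_of_pos (by positivity)
  rw [abs_div, abs_pow, abs_neg, abs_one, one_pow, abs_of_pos hG, one_div_mul_eq_div,
    div_le_iff₀ hG]
  calc R ^ k ≤ (1 / 2 * (2 * R + 1)) ^ k := by gcongr; linarith
    _ = Real.exp A * (1 / 2) ^ k * ((2 * R + 1) ^ k * Real.exp (-A)) := by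
        rw [mul_pow, Real.exp_neg]; field_simp
    _ ≤ _ := by gcongr

theorem EntireCoeff.deriv {c : ℕ → ℝ} (hc : EntireCoeff c) :
    EntireCoeff fun k => (k + 1) * c (k + 1) := by
  intro R hR
  refine Summable.of_nonneg_of_le (fun k => by positivity) (fun k => ?_)
    ((summable_nat_add_iff 1).2 (hc (2 * (R + 1)) (by positivity)))
  have hk : ((k : ℝ) + 1) ≤ 2 ^ (k + 1) := by
    exact_mod_cast (Nat.lt_two_pow_self (n := k + 1)).le
  have hR' : R ^ k ≤ (R + 1) ^ (k + 1) :=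
    (pow_le_pow_left₀ hR (by linarith) k).trans
      (pow_le_pow_right₀ (by linarith) (Nat.le_succ k))
  rw [abs_mul, abs_of_nonneg (by positivity : (0 : ℝ) ≤ (k : ℝ) + 1), mul_pow]
  calc ((k : ℝ) + 1) * |c (k + 1)| * R ^ k
      ≤ 2 ^ (k + 1) * |c (k + 1)| * (R + 1) ^ (k + 1) := by gcongr
    _ = _ := by ring

theorem EntireCoeff.summable {c : ℕ → ℝ} (hc : EntireCoeff c) (x : ℝ) :
    Summable fun k => c k * x ^ k := by
  refine Summable.of_norm ?_
  simpa [abs_mul, abs_pow] using hc |x| (abs_nonneg x)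

theorem EntireCoeff.hasDerivAt {c : ℕ → ℝ} (hc : EntireCoeff c) (x : ℝ) :
    HasDerivAt (fun y => ∑' k, c k * y ^ k) (∑' k : ℕ, (k + 1) * c (k + 1) * x ^ k) x := by
  set R := |x| + 1
  have hu : Summable fun k : ℕ => |c k| * (k * R ^ (k - 1)) := by
    rw [← summable_nat_add_iff 1]
    refine (hc.deriv R (by positivity)).congr fun k => ?_
    rw [abs_mul, abs_of_nonneg (by positivity : (0 : ℝ) ≤ (k : ℝ) + 1)]
    simp only [Nat.add_sub_cancel, Nat.cast_add, Nat.cast_one]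
    ring
  have key := hasDerivAt_tsum_of_isPreconnected (t := Metric.ball (0 : ℝ) R)
    (g := fun k y => c k * y ^ k) (g' := fun k y => c k * (k * y ^ (k - 1))) (y₀ := 0) (y := x)
    hu Metric.isOpen_ball (convex_ball _ _).isPreconnected
    (fun k y _ => (hasDerivAt_pow k y).const_mul _)
    (fun k y hy => by
      have : |y| ≤ R := by simpa using (Metric.mem_ball.1 hy).le
      rw [norm_mul, norm_mul, norm_pow, Real.norm_eq_abs, Real.norm_eq_abs, Real.norm_eq_abs,
        Nat.abs_cast]
      gcongr)
    (by simp; positivity) (hc.summable 0) (by simp [R])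
  have hs : Summable fun k : ℕ => c k * (k * x ^ (k - 1)) := by
    refine hu.of_norm_bounded fun k => ?_
    rw [norm_mul, norm_mul, norm_pow, Real.norm_eq_abs, Real.norm_eq_abs, Real.norm_eq_abs,
        Nat.abs_cast]
    gcongr
    simp [R]
  rw [hs.tsum_eq_zero_add] at key
  simp only [Nat.cast_zero, zero_mul, mul_zero, zero_add, Nat.add_sub_cancel] at key
  have heq : ∑' k : ℕ, (k + 1) * c (k + 1) * x ^ k =
      ∑' k : ℕ, c (k + 1) * (((k + 1 : ℕ) : ℝ) * x ^ k) :=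
    tsum_congr fun k => by push_cast; ring
  rwa [heq]

theorem intervalIntegrable_rpow_mul_sub_rpow {a b t : ℝ} (ha : 0 < a) (hb : 0 < b) (ht : 0 < t) :
    IntervalIntegrable (fun r => (t - r) ^ (a - 1) * r ^ (b - 1)) volume 0 t := by
  have h1 : ∀ a b : ℝ, 0 < b →
      IntervalIntegrable (fun r => (t - r) ^ (a - 1) * r ^ (b - 1)) volume 0 (t / 2) := by
    intro a b hb
    refine (intervalIntegral.intervalIntegrable_rpow' (by linarith)).continuousOn_mul ?_
    intro r hr
    rw [Set.uIcc_of_le (by positivity)] at hr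
    have : t - r ≠ 0 := by linarith [hr.2]
    exact (ContinuousAt.rpow_const (by fun_prop) (Or.inl this)).continuousWithinAt
  refine (h1 a b hb).trans ?_
  have h2 := ((h1 b a ha).comp_sub_left t).symm
  convert h2 using 1
  · ext r; rw [sub_sub_cancel, mul_comm]
  · ring
  · ring

theorem integral_rpow_mul_sub_rpow {a b t : ℝ} (ha : 0 < a) (hb : 0 < b) (ht : 0 < t) :
    ∫ r in 0..t, (t - r) ^ (a - 1) * r ^ (b - 1) =
      t ^ (a + b - 1) * (Real.Gamma a * Real.Gamma b / Real.Gamma (a + b)) := by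
  have h := Complex.betaIntegral_scaled b a ht
  rw [Complex.betaIntegral_eq_Gamma_mul_div _ _ (by simpa) (by simpa)] at h
  have h2 : ∀ x ∈ Set.uIcc 0 t, (x : ℂ) ^ ((b : ℂ) - 1) * ((t : ℂ) - x) ^ ((a : ℂ) - 1) =
      (((t - x) ^ (a - 1) * x ^ (b - 1) : ℝ) : ℂ) := by
    intro x hx
    rw [Set.uIcc_of_le ht.le] at hx
    push_cast [Complex.ofReal_cpow hx.1, Complex.ofReal_cpow (sub_nonneg.2 hx.2)]
    ring
  rw [intervalIntegral.integral_congr h2, intervalIntegral.integral_ofReal] at h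
  rw [← Complex.ofReal_inj, h]
  push_cast [Complex.ofReal_cpow ht.le, ← Complex.Gamma_ofReal]
  rw [add_comm (b : ℂ), mul_comm (Complex.Gamma b)]

/-- Termwise Riemann-Liouville fractional integration of a power series in `r ^ β`. -/
theorem EntireCoeff.hasSum_integral {c : ℕ → ℝ} (hc : EntireCoeff c) {a b β t : ℝ}
    (ha : 0 < a) (hb : 0 < b) (hβ : 0 < β) (ht : 0 < t) :
    HasSum (fun k : ℕ => c k * (t ^ (a + (b + β * k) - 1) *
        (Real.Gamma a * Real.Gamma (b + β * k) / Real.Gamma (a + (b + β * k)))))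
      (∫ r in 0..t, (t - r) ^ (a - 1) * (r ^ (b - 1) * ∑' k, c k * (r ^ β) ^ k)) := by
  have hterm : ∀ k : ℕ, ∫ r in 0..t, c k * ((t - r) ^ (a - 1) * r ^ (b + β * k - 1)) =
      c k * (t ^ (a + (b + β * k) - 1) *
        (Real.Gamma a * Real.Gamma (b + β * k) / Real.Gamma (a + (b + β * k)))) := by
    intro k
    rw [intervalIntegral.integral_const_mul, integral_rpow_mul_sub_rpow ha (by positivity) ht]
  simp_rw [← hterm]
  have hmeas := (intervalIntegrable_rpow_mul_sub_rpow ha hb ht)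
  have hpow : ∀ r : ℝ, 0 < r → ∀ k : ℕ, r ^ (b + β * k - 1) = r ^ (b - 1) * (r ^ β) ^ k := by
    intro r hr k
    rw [← Real.rpow_natCast, ← Real.rpow_mul hr.le, ← Real.rpow_add hr]
    ring_nf
  refine intervalIntegral.hasSum_integral_of_dominated_convergence
    (fun k r => |c k| * (t ^ β) ^ k * ((t - r) ^ (a - 1) * r ^ (b - 1))) (fun k => ?_)
    (fun k => ?_) ?_ ?_ ?_
  · exact ((((measurable_const.sub measurable_id).pow_const _).mul
      (measurable_id.pow_const _)).const_mul _).aestronglyMeasurable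
  · refine .of_forall fun r hr => ?_
    rw [Set.uIoc_of_le ht.le] at hr
    have h0 := hr.1
    have h1 := sub_nonneg.2 hr.2
    rw [hpow r hr.1, norm_mul, Real.norm_eq_abs, Real.norm_of_nonneg (by positivity)]
    calc |c k| * ((t - r) ^ (a - 1) * (r ^ (b - 1) * (r ^ β) ^ k))
        ≤ |c k| * ((t - r) ^ (a - 1) * (r ^ (b - 1) * (t ^ β) ^ k)) := by
          gcongr
          exact hr.2
      _ = _ := by ring
  · exact .of_forall fun r _ => (hc (t ^ β) (by positivity)).mul_right _
  · simp_rw [tsum_mul_right]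
    exact hmeas.const_mul _
  · refine .of_forall fun r hr => ?_
    rw [Set.uIoc_of_le ht.le] at hr
    simp_rw [hpow r hr.1]
    rw [← mul_assoc]
    have h := (hc.summable (r ^ β)).hasSum.mul_left ((t - r) ^ (a - 1) * r ^ (b - 1))
    exact h.congr_fun fun k => by ring

theorem mittagLeffler_neg_eq (β x : ℝ) :
    mittagLeffler β (-x) = ∑' k : ℕ, (-1) ^ k / Real.Gamma (1 + β * k) * x ^ k :=
  tsum_congr fun k => by rw [neg_pow]; ring

theorem mittagLeffler_zero (β : ℝ) : mittagLeffler β 0 = 1 := by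
  rw [mittagLeffler, tsum_eq_single 0 (fun k hk => by simp [hk])]
  simp

/-- The function `E_{β,β}(-x) = ∑_{k=0}^∞ (-x)^k / Γ(β + βk)`. -/
noncomputable def mittagLefflerDensity (β x : ℝ) : ℝ :=
  ∑' k : ℕ, (-1) ^ k / Real.Gamma (β + β * k) * x ^ k

section

variable {β : ℝ}

theorem inv_Gamma_add_mul_eq (hβ : 0 < β) (k : ℕ) :
    (-1) ^ k / Real.Gamma (β + β * k) =
      -β * ((k + 1) * ((-1) ^ (k + 1) / Real.Gamma (1 + β * ((k + 1 : ℕ) : ℝ)))) := by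
  have h : 0 < β + β * k := by positivity
  have hG := Real.Gamma_pos_of_pos h
  have : 1 + β * ((k + 1 : ℕ) : ℝ) = (β + β * k) + 1 := by push_cast; ring
  rw [this, Real.Gamma_add_one h.ne']
  field_simp
  ring

theorem entireCoeff_inv_Gamma_add_mul (hβ : 0 < β) :
    EntireCoeff fun k => (-1) ^ k / Real.Gamma (β + β * k) := by
  intro R hR
  refine (((entireCoeff_inv_Gamma hβ).deriv R hR).mul_left β).congr fun k => ?_
  beta_reduce
  rw [inv_Gamma_add_mul_eq hβ k, abs_mul (-β), abs_neg, abs_of_pos hβ, mul_assoc]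

theorem hasDerivAt_mittagLeffler_neg (hβ : 0 < β) (x : ℝ) :
    HasDerivAt (fun y => mittagLeffler β (-y)) (-(mittagLefflerDensity β x / β)) x := by
  simp_rw [mittagLeffler_neg_eq]
  convert (entireCoeff_inv_Gamma hβ).hasDerivAt x using 1
  simp_rw [mittagLefflerDensity, inv_Gamma_add_mul_eq hβ, mul_assoc (-β)]
  rw [tsum_mul_left]
  field_simp

theorem differentiable_mittagLefflerDensity (hβ : 0 < β) :
    Differentiable ℝ (mittagLefflerDensity β) := fun x =>
  ((entireCoeff_inv_Gamma_add_mul hβ).hasDerivAt x).differentiableAt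

theorem hasDerivAt_mittagLeffler_neg_rpow (hβ : 0 < β) {t : ℝ} (ht : 0 < t) :
    HasDerivAt (fun t => mittagLeffler β (-t ^ β))
      (-(t ^ (β - 1) * mittagLefflerDensity β (t ^ β))) t := by
  have h := (hasDerivAt_mittagLeffler_neg hβ (t ^ β)).comp t
    (Real.hasDerivAt_rpow_const (p := β) (Or.inl ht.ne'))
  refine h.congr_deriv ?_
  field_simp

theorem continuous_mittagLeffler_neg_rpow (hβ : 0 < β) :
    Continuous fun t => mittagLeffler β (-t ^ β) := by
  have h : Continuous fun y => mittagLeffler β (-y) :=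
    continuous_iff_continuousAt.2 fun x => (hasDerivAt_mittagLeffler_neg hβ x).continuousAt
  exact h.comp (Real.continuous_rpow_const hβ.le)

theorem continuous_mittagLefflerDensity_rpow (hβ : 0 < β) :
    Continuous fun t => mittagLefflerDensity β (t ^ β) :=
  (differentiable_mittagLefflerDensity hβ).continuous.comp (Real.continuous_rpow_const hβ.le)

theorem intervalIntegrable_density (hβ : 0 < β) (a b : ℝ) :
    IntervalIntegrable (fun r => r ^ (β - 1) * mittagLefflerDensity β (r ^ β)) volume a b :=
  (intervalIntegral.intervalIntegrable_rpow' (by linarith)).mul_continuousOn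
    (continuous_mittagLefflerDensity_rpow hβ).continuousOn

theorem intervalIntegrable_sub_rpow_mul_density (hβ : β ∈ Set.Ioo (0 : ℝ) 1) {t : ℝ}
    (ht : 0 < t) :
    IntervalIntegrable (fun r => (t - r) ^ (-β) *
      (r ^ (β - 1) * mittagLefflerDensity β (r ^ β))) volume 0 t := by
  have h := (intervalIntegrable_rpow_mul_sub_rpow (sub_pos.2 hβ.2) hβ.1 ht).mul_continuousOn
    (continuous_mittagLefflerDensity_rpow hβ.1).continuousOn
  simpa only [mul_assoc, sub_sub_cancel_left] using h

theorem integral_density (hβ : 0 < β) {t : ℝ} (ht : 0 ≤ t) :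
    ∫ r in 0..t, r ^ (β - 1) * mittagLefflerDensity β (r ^ β) =
      1 - mittagLeffler β (-t ^ β) := by
  have h := intervalIntegral.integral_eq_sub_of_hasDerivAt_of_le ht
    (continuous_mittagLeffler_neg_rpow hβ).continuousOn
    (fun x hx => hasDerivAt_mittagLeffler_neg_rpow hβ hx.1) (intervalIntegrable_density hβ 0 t).neg
  rw [Real.zero_rpow hβ.ne', neg_zero, mittagLeffler_zero] at h
  simp only [intervalIntegral.integral_neg] at h
  linarith

theorem integral_sub_rpow_mul_density (hβ : β ∈ Set.Ioo (0 : ℝ) 1) {t : ℝ} (ht : 0 < t) :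
    ∫ r in 0..t, (t - r) ^ (-β) * (r ^ (β - 1) * mittagLefflerDensity β (r ^ β)) =
      Real.Gamma (1 - β) * mittagLeffler β (-t ^ β) := by
  have h := (entireCoeff_inv_Gamma_add_mul hβ.1).hasSum_integral (sub_pos.2 hβ.2) hβ.1 hβ.1 ht
  rw [sub_sub_cancel_left] at h
  rw [mittagLeffler_neg_eq, ← tsum_mul_left]
  refine h.tsum_eq.symm.trans (tsum_congr fun k => ?_)
  have hG : 0 < Real.Gamma (β + β * k) :=
    Real.Gamma_pos_of_pos (by have := hβ.1; positivity)
  have h1 : 1 - β + (β + β * k) = 1 + β * k := by ring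
  rw [h1, add_sub_cancel_left, Real.rpow_mul ht.le, Real.rpow_natCast]
  generalize Real.Gamma (β + β * k) = G at hG
  field_simp

theorem integral_sub_rpow_mul_mittagLeffler (hβ : 0 < β) {t : ℝ} (ht : 0 < t) :
    ∫ r in 0..t, (t - r) ^ (β - 1) * mittagLeffler β (-r ^ β) =
      Real.Gamma β * (1 - mittagLeffler β (-t ^ β)) := by
  have h := (entireCoeff_inv_Gamma hβ).hasSum_integral hβ one_pos hβ ht
  simp_rw [sub_self, Real.rpow_zero, one_mul, ← mittagLeffler_neg_eq] at h
  rw [mittagLeffler_neg_eq, ((entireCoeff_inv_Gamma hβ).summable _).tsum_eq_zero_add]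
  simp only [pow_zero, Nat.cast_zero, mul_zero, add_zero, Real.Gamma_one, div_one, one_mul,
    sub_add_cancel_left]
  rw [← tsum_neg, ← tsum_mul_left]
  refine h.tsum_eq.symm.trans (tsum_congr fun k => ?_)
  have hG : 0 < Real.Gamma (1 + β * k) := Real.Gamma_pos_of_pos (by positivity)
  have h1 : β + (1 + β * k) = 1 + β * ((k + 1 : ℕ) : ℝ) := by push_cast; ring
  rw [h1, add_sub_cancel_left, Real.rpow_mul ht.le, Real.rpow_natCast, pow_succ (-1 : ℝ)]
  field_simp

/-- A lower bound for the decay of a negative power. -/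
theorem mul_sub_le_rpow_neg_sub (hβ : β ∈ Set.Ioo (0 : ℝ) 1) {x y T : ℝ} (hx : 0 < x)
    (hxy : x ≤ y) (hyT : y ≤ T) :
    β * T ^ (-β - 1) * (y - x) ≤ x ^ (-β) - y ^ (-β) := by
  have hy : 0 < y := hx.trans_le hxy
  have h := rpow_one_add_le_one_add_mul_self (s := (x - y) / y)
    (by rw [le_div_iff₀ hy]; linarith) hβ.1.le hβ.2.le
  have hxy' : 1 + (x - y) / y = x / y := by field_simp; ring
  rw [hxy', Real.div_rpow hx.le hy.le] at h
  have hδ : 0 ≤ (y - x) / y := div_nonneg (by linarith) hy.le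
  set δ := (y - x) / y with hδ_def
  have hneg : (x - y) / y = -δ := by rw [hδ_def]; ring
  rw [hneg] at h
  have hX : 0 < x ^ β := Real.rpow_pos_of_pos hx _
  have hY : 0 < y ^ β := Real.rpow_pos_of_pos hy _
  have hmain : y ^ (-β) * (β * δ) ≤ x ^ (-β) - y ^ (-β) := by
    rw [Real.rpow_neg hy.le, Real.rpow_neg hx.le]
    have hq : 0 < x ^ β / y ^ β := div_pos hX hY
    have h3 : 1 + β * δ ≤ (x ^ β / y ^ β)⁻¹ := by
      rw [le_inv_comm₀ (by have := hβ.1; positivity) hq]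
      refine h.trans ?_
      rw [← one_div, le_div_iff₀ (by have := hβ.1; positivity)]
      nlinarith [sq_nonneg (β * δ)]
    have h4 : (x ^ β)⁻¹ = (y ^ β)⁻¹ * (x ^ β / y ^ β)⁻¹ := by field_simp
    rw [h4]
    nlinarith [mul_le_mul_of_nonneg_left h3 (inv_pos.2 hY).le]
  refine le_trans ?_ hmain
  have hpow : T ^ (-β - 1) ≤ y ^ (-β - 1) :=
    Real.rpow_le_rpow_of_nonpos hy hyT (by linarith [hβ.1])
  calc β * T ^ (-β - 1) * (y - x) ≤ β * y ^ (-β - 1) * (y - x) := by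
        have := hβ.1
        have := sub_nonneg.2 hxy
        gcongr
    _ = _ := by rw [Real.rpow_sub_one hy.ne', hδ_def]; ring

theorem integral_sub_rpow {a t T : ℝ} (ha : 0 < a) :
    ∫ r in t..T, (T - r) ^ (a - 1) = (T - t) ^ a / a := by
  rw [intervalIntegral.integral_comp_sub_left (fun r => r ^ (a - 1)), sub_self,
    integral_rpow (Or.inl (by linarith)), sub_add_cancel, Real.zero_rpow ha.ne', sub_zero]

open Filter Topology

/-- `t ↦ E_{β,β}(-t ^ β)` has no first zero. -/
theorem mittagLefflerDensity_rpow_ne_zero (hβ : β ∈ Set.Ioo (0 : ℝ) 1) {T : ℝ} (hT : 0 < T)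
    (hpos : ∀ r ∈ Set.Ioo 0 T, 0 < mittagLefflerDensity β (r ^ β)) :
    mittagLefflerDensity β (T ^ β) ≠ 0 := by
  intro hzero
  set v : ℝ → ℝ := fun r => r ^ (β - 1) * mittagLefflerDensity β (r ^ β) with hv
  set u : ℝ → ℝ := fun t => mittagLeffler β (-t ^ β) with hu
  have hvpos : ∀ r ∈ Set.Ioo 0 T, 0 < v r := fun r hr =>
    mul_pos (Real.rpow_pos_of_pos hr.1 _) (hpos r hr)
  have hvT : v T = 0 := by simp [hv, hzero]
  have hvdiff : DifferentiableAt ℝ v T :=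
    (Real.differentiableAt_rpow_const_of_ne _ hT.ne').mul
      (((differentiable_mittagLefflerDensity hβ.1) _).comp T
        (Real.differentiableAt_rpow_const_of_ne _ hT.ne'))
  obtain ⟨C, hC0, hC⟩ := hvdiff.isBigO_sub.exists_pos
  obtain ⟨ε, hε, hball⟩ := Metric.eventually_nhds_iff.1 hC.bound
  have huT : 0 < 1 - u T := by
    rw [hu, ← integral_density hβ.1 hT.le]
    exact intervalIntegral.intervalIntegral_pos_of_pos_on (intervalIntegrable_density hβ.1 0 T)
      hvpos hT
  have hudiff : HasDerivAt u 0 T := by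
    have h := hasDerivAt_mittagLeffler_neg_rpow hβ.1 hT
    rwa [hzero, mul_zero, neg_zero] at h
  set m := β * T ^ (-β - 1) with hm
  have hm0 : 0 < m := mul_pos hβ.1 (Real.rpow_pos_of_pos hT _)
  have hbound : ∀ᶠ t in 𝓝[<] T, m * (1 - u t) ≤
      C * ((T - t) ^ (1 - β) / (1 - β)) - Real.Gamma (1 - β) * slope u T t := by
    have hnear : ∀ᶠ t in 𝓝[<] T, T - ε < t ∧ 0 < t :=
      nhdsWithin_le_nhds ((lt_mem_nhds (by linarith)).and (lt_mem_nhds hT))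
    filter_upwards [hnear, self_mem_nhdsWithin] with t ht htT
    obtain ⟨htε, ht0⟩ := ht
    replace htT : t < T := htT
    have hint : IntervalIntegrable (fun r => (T - r) ^ (-β) * v r) volume 0 T :=
      intervalIntegrable_sub_rpow_mul_density hβ hT
    have hint₁ : IntervalIntegrable (fun r => (T - r) ^ (-β) * v r) volume 0 t :=
      hint.mono_set (by
        rw [Set.uIcc_of_le ht0.le, Set.uIcc_of_le hT.le]
        exact Set.Icc_subset_Icc_right htT.le)
    have hint₂ : IntervalIntegrable (fun r => (T - r) ^ (-β) * v r) volume t T :=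
      hint.mono_set (by
        rw [Set.uIcc_of_le htT.le, Set.uIcc_of_le hT.le]
        exact Set.Icc_subset_Icc_left ht0.le)
    have hint₃ : IntervalIntegrable (fun r => (t - r) ^ (-β) * v r) volume 0 t :=
      intervalIntegrable_sub_rpow_mul_density hβ ht0
    have hA : m * (T - t) * (1 - u t) ≤
        (∫ r in 0..t, (t - r) ^ (-β) * v r) - ∫ r in 0..t, (T - r) ^ (-β) * v r := by
      rw [hu, ← integral_density hβ.1 ht0.le, ← intervalIntegral.integral_const_mul,
        ← intervalIntegral.integral_sub hint₃ hint₁]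
      refine intervalIntegral.integral_mono_on_of_le_Ioo ht0.le
        ((intervalIntegrable_density hβ.1 0 t).const_mul _) (hint₃.sub hint₁) fun r hr => ?_
      have h := mul_sub_le_rpow_neg_sub hβ (x := t - r) (y := T - r) (T := T)
        (by linarith [hr.2]) (by linarith) (by linarith [hr.1])
      rw [sub_sub_sub_cancel_right] at h
      rw [← sub_mul]
      exact mul_le_mul_of_nonneg_right h (hvpos r ⟨hr.1, hr.2.trans htT⟩).le
    have hB : ∫ r in t..T, (T - r) ^ (-β) * v r ≤
        C * (T - t) * ((T - t) ^ (1 - β) / (1 - β)) := by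
      rw [← integral_sub_rpow (sub_pos.2 hβ.2), ← intervalIntegral.integral_const_mul]
      rw [sub_sub_cancel_left]
      have hint₄ : IntervalIntegrable (fun r => (T - r) ^ (-β)) volume t T := by
        have h := (intervalIntegral.intervalIntegrable_rpow' (a := T - t) (b := T - T)
          (r := -β) (by linarith [hβ.2])).comp_sub_left T
        simpa using h
      refine intervalIntegral.integral_mono_on_of_le_Ioo htT.le hint₂
        (hint₄.const_mul _) fun r hr => ?_
      have h1 : dist r T < ε := by
        rw [Real.dist_eq, abs_sub_comm, abs_of_pos (by linarith [hr.2])]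
        linarith [hr.1]
      have h2 := hball h1
      rw [hvT, sub_zero, norm_sub_rev, Real.norm_eq_abs, Real.norm_eq_abs,
        abs_of_pos (sub_pos.2 hr.2)] at h2
      have h3 : v r ≤ C * (T - t) := (le_abs_self _).trans (h2.trans (by gcongr; exact hr.1.le))
      have h4 : 0 ≤ (T - r) ^ (-β) := Real.rpow_nonneg (by linarith [hr.2]) _
      nlinarith [mul_le_mul_of_nonneg_left h3 h4]
    have hsplit := intervalIntegral.integral_add_adjacent_intervals hint₁ hint₂
    rw [hv, integral_sub_rpow_mul_density hβ hT] at hsplit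
    rw [hv, integral_sub_rpow_mul_density hβ ht0] at hA
    have hslope : (T - t) * slope u T t = u T - u t := by
      rw [slope_def_field]
      have : t - T ≠ 0 := by linarith
      field_simp
      ring
    refine le_of_mul_le_mul_left ?_ (sub_pos.2 htT)
    have hΓ : (T - t) * (Real.Gamma (1 - β) * slope u T t) =
        Real.Gamma (1 - β) * u T - Real.Gamma (1 - β) * u t := by
      rw [mul_left_comm, hslope, mul_sub]
    rw [mul_sub (T - t) (C * _), hΓ]
    simp only [hu, hv] at hA hB hsplit ⊢
    nlinarith
  have hlim₁ : Tendsto (fun t => m * (1 - u t)) (𝓝[<] T) (𝓝 (m * (1 - u T))) :=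
    ((hudiff.continuousAt.tendsto.const_sub 1).const_mul m).mono_left nhdsWithin_le_nhds
  have hlim₂ : Tendsto (fun t => C * ((T - t) ^ (1 - β) / (1 - β)) -
      Real.Gamma (1 - β) * slope u T t) (𝓝[<] T) (𝓝 0) := by
    have h1 : ContinuousAt (fun t => C * ((T - t) ^ (1 - β) / (1 - β))) T :=
      (((continuous_const.sub continuous_id).rpow_const
        fun _ => Or.inr (by linarith [hβ.2])).div_const _ |>.const_mul C).continuousAt
    have h2 := h1.tendsto.mono_left (nhdsWithin_le_nhds (s := Set.Iio T))
    have h3 := (hudiff.tendsto_slope.mono_left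
      (nhdsWithin_mono T fun t (ht : t < T) => ht.ne)).const_mul (Real.Gamma (1 - β))
    have h4 := h2.sub h3
    rwa [sub_self, Real.zero_rpow (by linarith [hβ.2]), zero_div, mul_zero, mul_zero,
      sub_zero] at h4
  have := le_of_tendsto_of_tendsto hlim₁ hlim₂ hbound
  nlinarith

theorem mittagLefflerDensity_pos (hβ : β ∈ Set.Ioo (0 : ℝ) 1) {x : ℝ} (hx : 0 ≤ x) :
    0 < mittagLefflerDensity β x := by
  have hcont := (differentiable_mittagLefflerDensity hβ.1).continuous
  have hzero : 0 < mittagLefflerDensity β 0 := by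
    rw [mittagLefflerDensity, tsum_eq_single 0 (fun k hk => by simp [hk])]
    simpa using Real.Gamma_pos_of_pos hβ.1
  by_contra! hneg
  set S := {y | 0 ≤ y ∧ mittagLefflerDensity β y ≤ 0}
  have hclosed : IsClosed S :=
    (isClosed_le continuous_const continuous_id).inter (isClosed_le hcont continuous_const)
  have hbdd : BddBelow S := ⟨0, fun y hy => hy.1⟩
  obtain ⟨h0, hle⟩ := hclosed.csInf_mem ⟨x, hx, hneg⟩ hbdd
  have hbefore : ∀ y, 0 ≤ y → y < sInf S → 0 < mittagLefflerDensity β y := fun y hy hyS => by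
    by_contra! h
    exact (csInf_le hbdd ⟨hy, h⟩).not_gt hyS
  have hSpos : 0 < sInf S := h0.lt_of_ne fun h => by
    rw [← h] at hle
    linarith
  have hge : 0 ≤ mittagLefflerDensity β (sInf S) := by
    refine ge_of_tendsto (hcont.continuousAt.mono_left (nhdsWithin_le_nhds (s := Set.Iio (sInf S)))) ?_
    filter_upwards [Ioo_mem_nhdsLT hSpos] with y hy
    exact (hbefore y hy.1.le hy.2).le
  have hroot : (sInf S ^ β⁻¹) ^ β = sInf S := Real.rpow_inv_rpow h0 hβ.1.ne'
  refine mittagLefflerDensity_rpow_ne_zero hβ (Real.rpow_pos_of_pos hSpos β⁻¹)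
    (fun r hr => hbefore _ (Real.rpow_nonneg hr.1.le _) ?_) (by rw [hroot]; exact hle.antisymm hge)
  rw [← hroot]
  exact Real.rpow_lt_rpow hr.1.le hr.2 hβ.1

theorem antitoneOn_mittagLeffler_neg (hβ : β ∈ Set.Ioo (0 : ℝ) 1) :
    AntitoneOn (fun x => mittagLeffler β (-x)) (Set.Ici 0) := by
  have hd := hasDerivAt_mittagLeffler_neg hβ.1
  refine antitoneOn_of_deriv_nonpos (convex_Ici 0)
    (fun x _ => (hd x).continuousAt.continuousWithinAt)
    (fun x _ => (hd x).differentiableAt.differentiableWithinAt) fun x hx => ?_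
  rw [interior_Ici] at hx
  rw [(hd x).deriv]
  exact neg_nonpos.2 (div_pos (mittagLefflerDensity_pos hβ (Set.mem_Ioi.1 hx).le) hβ.1).le

theorem one_le_mul_mittagLeffler_neg_rpow (hβ : β ∈ Set.Ioo (0 : ℝ) 1) {t : ℝ} (ht : 0 < t) :
    1 ≤ mittagLeffler β (-t ^ β) * (1 + Real.Gamma (1 - β) * t ^ β) := by
  have hT := Real.rpow_pos_of_pos ht β
  have h : t ^ (-β) * (1 - mittagLeffler β (-t ^ β)) ≤
      Real.Gamma (1 - β) * mittagLeffler β (-t ^ β) := by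
    rw [← integral_density hβ.1 ht.le, ← integral_sub_rpow_mul_density hβ ht,
      ← intervalIntegral.integral_const_mul]
    refine intervalIntegral.integral_mono_on_of_le_Ioo ht.le
      ((intervalIntegrable_density hβ.1 0 t).const_mul _)
      (intervalIntegrable_sub_rpow_mul_density hβ ht) fun r hr => ?_
    have hd := mittagLefflerDensity_pos hβ (Real.rpow_nonneg hr.1.le β)
    have hr0 := Real.rpow_nonneg hr.1.le (β - 1)
    refine mul_le_mul_of_nonneg_right ?_ (by positivity)
    exact Real.rpow_le_rpow_of_nonpos (by linarith [hr.2]) (by linarith [hr.1])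
      (by linarith [hβ.1])
  rw [Real.rpow_neg ht.le, inv_mul_le_iff₀ hT] at h
  nlinarith

theorem mul_mittagLeffler_neg_rpow_le_one (hβ : β ∈ Set.Ioo (0 : ℝ) 1) {t : ℝ} (ht : 0 < t) :
    mittagLeffler β (-t ^ β) * (1 + t ^ β / Real.Gamma (1 + β)) ≤ 1 := by
  have hG := Real.Gamma_pos_of_pos hβ.1
  have hβ0 := hβ.1
  have hint : IntervalIntegrable (fun r => (t - r) ^ (β - 1)) volume 0 t := by
    simpa using intervalIntegrable_rpow_mul_sub_rpow hβ.1 one_pos ht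
  have h : t ^ β / β * mittagLeffler β (-t ^ β) ≤
      Real.Gamma β * (1 - mittagLeffler β (-t ^ β)) := by
    have hsub := integral_sub_rpow (t := 0) (T := t) hβ.1
    rw [sub_zero] at hsub
    rw [← integral_sub_rpow_mul_mittagLeffler hβ.1 ht, ← hsub,
      ← intervalIntegral.integral_mul_const]
    refine intervalIntegral.integral_mono_on_of_le_Ioo ht.le (hint.mul_const _)
      (hint.mul_continuousOn (continuous_mittagLeffler_neg_rpow hβ.1).continuousOn) fun r hr => ?_
    refine mul_le_mul_of_nonneg_left ?_ (Real.rpow_nonneg (by linarith [hr.2]) _)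
    exact antitoneOn_mittagLeffler_neg hβ (Real.rpow_nonneg hr.1.le _) (Real.rpow_nonneg ht.le _)
      (Real.rpow_le_rpow hr.1.le hr.2.le hβ.1.le)
  rw [add_comm 1 β, Real.Gamma_add_one hβ.1.ne']
  have h2 : t ^ β / (β * Real.Gamma β) * mittagLeffler β (-t ^ β) ≤
      1 - mittagLeffler β (-t ^ β) := by
    rw [← div_div, div_mul_eq_mul_div, div_le_iff₀ hG, mul_comm (1 - _)]
    exact h
  linarith

end

theorem mittagLeffler_two_sided_bound (β : ℝ) (hβ : β ∈ Set.Ioo (0 : ℝ) 1) :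
    ∀ s : ℝ, 0 ≤ s →
      (1 / (1 + Real.Gamma (1 - β) * s) ≤ mittagLeffler β (-s) ∧
        mittagLeffler β (-s) ≤ 1 / (1 + s / Real.Gamma (1 + β))) ∧
      (0 < mittagLeffler β (-s) ∧ mittagLeffler β (-s) ≤ 1) := by
  intro s hs
  rcases hs.eq_or_lt with rfl | hs
  · simp [mittagLeffler_zero]
  have hroot : (s ^ β⁻¹) ^ β = s := Real.rpow_inv_rpow hs.le hβ.1.ne'
  have ht : 0 < s ^ β⁻¹ := Real.rpow_pos_of_pos hs _
  have hlow := one_le_mul_mittagLeffler_neg_rpow hβ ht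
  have hupp := mul_mittagLeffler_neg_rpow_le_one hβ ht
  rw [hroot] at hlow hupp
  have hG₁ : 0 < Real.Gamma (1 - β) := Real.Gamma_pos_of_pos (sub_pos.2 hβ.2)
  have hG₂ : 0 < Real.Gamma (1 + β) := Real.Gamma_pos_of_pos (by linarith [hβ.1])
  have hlow' : 1 / (1 + Real.Gamma (1 - β) * s) ≤ mittagLeffler β (-s) :=
    (div_le_iff₀ (by positivity)).2 hlow
  have hupp' : mittagLeffler β (-s) ≤ 1 / (1 + s / Real.Gamma (1 + β)) :=
    (le_div_iff₀ (by positivity)).2 hupp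
  refine ⟨⟨hlow', hupp'⟩, lt_of_lt_of_le (by positivity) hlow', hupp'.trans ?_⟩
  rw [div_le_one (by positivity)]
  linarith [div_pos hs hG₂]
end

section
/- Let ν > 0 and a > 0, and let h be the Matérn kernel h(x) = (a|x|)^ν K_ν(a|x|) / (2^{ν−1} Γ(ν)) for x ≠ 0. Then for every λ ∈ ℝ, the Fourier transform satisfies ∫_ℝ e^{−iλx} h(x) dx = 2√π a^{2ν} Γ(ν + 1/2) / Γ(ν) · (a² + λ²)^{−(ν+1/2)}. -/
open Real MeasureTheory

/-- The modified Bessel function of the second kind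
`K_ν(z) = (1/2) ∫_0^∞ s^{ν-1} exp(-(z/2)(s + 1/s)) ds`. -/
noncomputable def besselK (ν z : ℝ) : ℝ :=
  (1 / 2) * ∫ s in Set.Ioi (0 : ℝ), s ^ (ν - 1) * Real.exp (-(z / 2) * (s + 1 / s))

/-- The Matérn kernel `h(x) = (a|x|)^ν K_ν(a|x|) / (2^{ν-1} Γ(ν))`. -/
noncomputable def maternKernel (ν a x : ℝ) : ℝ :=
  (a * |x|) ^ ν * besselK ν (a * |x|) / ((2 : ℝ) ^ (ν - 1) * Real.Gamma ν)

/-- Scaling the integration variable by `2 / z` in the definition of `besselK`. -/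
lemma rpow_mul_besselK (ν : ℝ) {z : ℝ} (hz : 0 < z) :
    z ^ ν * besselK ν z =
      2 ^ (ν - 1) * ∫ u in Set.Ioi (0 : ℝ), u ^ (ν - 1) * Real.exp (-u - z ^ 2 / (4 * u)) := by
  have hc : 0 < 2 / z := by positivity
  have hscale := integral_comp_mul_left_Ioi'
    (fun s : ℝ ↦ s ^ (ν - 1) * Real.exp (-(z / 2) * (s + 1 / s))) 0 hc
  rw [mul_zero, smul_eq_mul] at hscale
  have hcongr : ∀ u ∈ Set.Ioi (0 : ℝ),
      (2 / z * u) ^ (ν - 1) * Real.exp (-(z / 2) * (2 / z * u + 1 / (2 / z * u))) =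
        (2 / z) ^ (ν - 1) * (u ^ (ν - 1) * Real.exp (-u - z ^ 2 / (4 * u))) := by
    intro u hu
    have hu : 0 < u := hu
    rw [Real.mul_rpow hc.le hu.le, mul_assoc]
    congr 3
    field_simp
    ring
  rw [besselK, ← hscale, setIntegral_congr_fun measurableSet_Ioi hcongr, integral_const_mul,
    Real.div_rpow zero_le_two hz.le, Real.rpow_sub_one hz.ne',
    Real.rpow_sub_one two_ne_zero]
  generalize ∫ u in Set.Ioi (0 : ℝ), u ^ (ν - 1) * Real.exp (-u - z ^ 2 / (4 * u)) = J
  field_simp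

/-- The Matérn kernel is a scale mixture of Gaussians. -/
lemma maternKernel_eq_integral {ν a x : ℝ} (ha : 0 < a) (hx : x ≠ 0) :
    maternKernel ν a x = (Real.Gamma ν)⁻¹ *
      ∫ u in Set.Ioi (0 : ℝ),
        u ^ (ν - 1) * Real.exp (-u) * Real.exp (-(a ^ 2 / (4 * u)) * x ^ 2) := by
  have hz : 0 < a * |x| := by positivity
  rw [maternKernel, rpow_mul_besselK ν hz, mul_div_mul_left _ _ (by positivity), div_eq_inv_mul]
  congr 1
  refine integral_congr_ae (.of_forall fun u ↦ ?_)
  simp only [mul_assoc, ← Real.exp_add, mul_pow, sq_abs]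
  congr 2
  ring

lemma sqrt_pi_div_gaussian_rate {a u : ℝ} (ha : 0 < a) :
    √(π / (a ^ 2 / (4 * u))) = 2 * √π / a * u ^ (1 / 2 : ℝ) := by
  have h : π / (a ^ 2 / (4 * u)) = (2 / a) ^ 2 * (π * u) := by field_simp; ring
  rw [h, Real.sqrt_mul (by positivity), Real.sqrt_sq (by positivity),
    Real.sqrt_mul Real.pi_pos.le, Real.sqrt_eq_rpow u]
  ring

/-- The Fourier transform of a single Gaussian in the scale mixture. -/
lemma integral_cexp_mul_gaussian {a u : ℝ} (ha : 0 < a) (hu : 0 < u) (l : ℝ) :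
    ∫ x : ℝ, Complex.exp (-(Complex.I * l * x)) *
        (Real.exp (-(a ^ 2 / (4 * u)) * x ^ 2) : ℂ) =
      ((2 * √π / a * u ^ (1 / 2 : ℝ) * Real.exp (-(l ^ 2 / a ^ 2 * u)) : ℝ) : ℂ) := by
  have hb : 0 < a ^ 2 / (4 * u) := by positivity
  have h := fourierIntegral_gaussian (b := ((a ^ 2 / (4 * u) : ℝ) : ℂ)) (by rwa [Complex.ofReal_re]) (-l)
  have hpow : ((π : ℂ) / ((a ^ 2 / (4 * u) : ℝ) : ℂ)) ^ (1 / 2 : ℂ) =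
      ((2 * √π / a * u ^ (1 / 2 : ℝ) : ℝ) : ℂ) := by
    rw [← sqrt_pi_div_gaussian_rate ha, Real.sqrt_eq_rpow, Complex.ofReal_cpow (by positivity)]
    push_cast
    rfl
  rw [hpow] at h
  rw [Complex.ofReal_mul, Complex.ofReal_exp]
  convert h using 3 with x
  · push_cast
    congr 2
    ring
  · push_cast
    have : (a : ℂ) ≠ 0 := by exact_mod_cast ha.ne'
    have : (u : ℂ) ≠ 0 := by exact_mod_cast hu.ne'
    field_simp

lemma integrable_gaussian_mixture {ν a : ℝ} (hν : 0 < ν) (ha : 0 < a) (l : ℝ) :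
    Integrable (fun p : ℝ × ℝ ↦ Complex.exp (-(Complex.I * l * p.1)) *
        ((p.2 ^ (ν - 1) * Real.exp (-p.2) * Real.exp (-(a ^ 2 / (4 * p.2)) * p.1 ^ 2) : ℝ) : ℂ))
      (volume.prod (volume.restrict (Set.Ioi 0))) := by
  have hnorm : ∀ x u : ℝ, 0 < u → ‖Complex.exp (-(Complex.I * l * x)) *
      ((u ^ (ν - 1) * Real.exp (-u) * Real.exp (-(a ^ 2 / (4 * u)) * x ^ 2) : ℝ) : ℂ)‖ =
        u ^ (ν - 1) * Real.exp (-u) * Real.exp (-(a ^ 2 / (4 * u)) * x ^ 2) := by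
    intro x u hu
    rw [norm_mul, Complex.norm_exp, Complex.norm_real, Real.norm_of_nonneg (by positivity)]
    simp
  have hmeas : Measurable (fun p : ℝ × ℝ ↦ Complex.exp (-(Complex.I * l * p.1)) *
      ((p.2 ^ (ν - 1) * Real.exp (-p.2) *
        Real.exp (-(a ^ 2 / (4 * p.2)) * p.1 ^ 2) : ℝ) : ℂ)) := by
    fun_prop
  rw [integrable_prod_iff' hmeas.aestronglyMeasurable]
  constructor
  · filter_upwards [ae_restrict_mem measurableSet_Ioi] with u hu
    have hu : 0 < u := hu
    have hgauss := (integrable_exp_neg_mul_sq (b := a ^ 2 / (4 * u)) (by positivity)).const_mul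
      (u ^ (ν - 1) * Real.exp (-u))
    refine hgauss.mono' (by fun_prop) (.of_forall fun x ↦ (hnorm x u hu).le)
  · have hΓ := (Real.GammaIntegral_convergent (s := ν + 1 / 2) (by positivity)).const_mul
      (2 * √π / a)
    refine IntegrableOn.congr_fun hΓ (fun u hu ↦ ?_) measurableSet_Ioi
    have hu : 0 < u := hu
    simp only [hnorm _ u hu]
    rw [integral_const_mul, integral_gaussian, sqrt_pi_div_gaussian_rate ha,
      show ν + 1 / 2 - 1 = (ν - 1) + 1 / 2 by ring, Real.rpow_add hu]
    ring

/-- The Fourier transform of the Matérn kernel: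
`∫_ℝ e^{-iλx} h(x) dx = 2√π a^{2ν} Γ(ν+1/2)/Γ(ν) (a²+λ²)^{-(ν+1/2)}`. -/
theorem fourier_transform_matern (ν a : ℝ) (hν : 0 < ν) (ha : 0 < a) (l : ℝ) :
    ∫ x : ℝ, Complex.exp (-(Complex.I * l * x)) * (maternKernel ν a x : ℂ) =
      ((2 * Real.sqrt π * a ^ (2 * ν) * Real.Gamma (ν + 1 / 2) / Real.Gamma ν *
          (a ^ 2 + l ^ 2) ^ (-(ν + 1 / 2)) : ℝ) : ℂ) := by
  have hmix : ∀ᵐ x : ℝ, Complex.exp (-(Complex.I * l * x)) * (maternKernel ν a x : ℂ) =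
      ((Real.Gamma ν)⁻¹ : ℝ) * ∫ u in Set.Ioi (0 : ℝ), Complex.exp (-(Complex.I * l * x)) *
        ((u ^ (ν - 1) * Real.exp (-u) * Real.exp (-(a ^ 2 / (4 * u)) * x ^ 2) : ℝ) : ℂ) := by
    filter_upwards [Measure.ae_ne volume (0 : ℝ)] with x hx
    rw [maternKernel_eq_integral ha hx, integral_const_mul, integral_complex_ofReal,
      Complex.ofReal_mul]
    ring
  have hinner : ∀ u ∈ Set.Ioi (0 : ℝ), ∫ x : ℝ, Complex.exp (-(Complex.I * l * x)) *
      ((u ^ (ν - 1) * Real.exp (-u) * Real.exp (-(a ^ 2 / (4 * u)) * x ^ 2) : ℝ) : ℂ) =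
        ((2 * √π / a * (u ^ (ν + 1 / 2 - 1) * Real.exp (-((1 + l ^ 2 / a ^ 2) * u))) : ℝ) : ℂ) := by
    intro u hu
    have hu : 0 < u := hu
    simp only [Complex.ofReal_mul (u ^ (ν - 1) * Real.exp (-u)),
      mul_left_comm _ ((u ^ (ν - 1) * Real.exp (-u) : ℝ) : ℂ)]
    rw [integral_const_mul, integral_cexp_mul_gaussian ha hu, ← Complex.ofReal_mul,
      show ν + 1 / 2 - 1 = (ν - 1) + 1 / 2 by ring, Real.rpow_add hu,
      show -((1 + l ^ 2 / a ^ 2) * u) = -u + -(l ^ 2 / a ^ 2 * u) by ring, Real.exp_add]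
    congr 1
    ring
  have hscale : (1 / (1 + l ^ 2 / a ^ 2)) ^ (ν + 1 / 2) =
      a ^ (2 * ν) * a * (a ^ 2 + l ^ 2) ^ (-(ν + 1 / 2)) := by
    have h : 1 / (1 + l ^ 2 / a ^ 2) = a ^ 2 / (a ^ 2 + l ^ 2) := by field_simp
    rw [h, Real.div_rpow (by positivity) (by positivity), Real.rpow_neg (by positivity),
      ← Real.rpow_natCast_mul ha.le, ← Real.rpow_add_one ha.ne', div_eq_mul_inv]
    congr 2
    push_cast
    ring
  rw [integral_congr_ae hmix, integral_const_mul,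
    integral_integral_swap (integrable_gaussian_mixture hν ha l),
    setIntegral_congr_fun measurableSet_Ioi hinner, integral_complex_ofReal, integral_const_mul,
    Real.integral_rpow_mul_exp_neg_mul_Ioi (by positivity) (by positivity), hscale,
    ← Complex.ofReal_mul]
  congr 1
  field_simp
end

section
/- Let β ∈ (0,1), μ > 0, α ≥ 0 and η ∈ (0,1]. There exists a constant C > 0 such that for all λ ∈ ℝ and all t, s > 0, |E_β(−μ t^β |λ|^α) − E_β(−μ s^β |λ|^α)| ≤ C |λ|^{ηα} |t − s|^{ηβ}. -/
open Real MeasureTheory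

open Filter Topology Finset

/-- The `n`-th Euler approximant of `Γ(1 + z)`. -/
noncomputable def eulerGamma (n : ℕ) (z : ℝ) : ℝ :=
  (n : ℝ) ^ z * ∏ j ∈ range n, ((j : ℝ) + 1) / (j + 1 + z)

/-- The multiplier `∏_{j=1}^n (j + βk) / (j + k)`. It is the `k`-th moment of a product of
independent `[0, 1]`-valued variables, which is why it preserves bounds on power series. -/
noncomputable def gammaRatio (β : ℝ) (n k : ℕ) : ℝ :=
  ∏ j ∈ range n, ((j : ℝ) + 1 + β * k) / (j + 1 + k)

lemma eulerGamma_pos {n : ℕ} (hn : 0 < n) {z : ℝ} (hz : 0 ≤ z) : 0 < eulerGamma n z := by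
  unfold eulerGamma
  have : (0 : ℝ) < n := by exact_mod_cast hn
  exact mul_pos (rpow_pos_of_pos this z) (prod_pos fun j _ => by positivity)

lemma eulerGamma_le_succ {n : ℕ} (hn : 0 < n) {z : ℝ} (hz : 0 ≤ z) :
    eulerGamma n z ≤ eulerGamma (n + 1) z := by
  have hn' : (0 : ℝ) < n := by exact_mod_cast hn
  have hlog : 1 - ((n + 1 : ℝ) / n)⁻¹ ≤ log ((n + 1 : ℝ) / n) :=
    one_sub_inv_le_log_of_pos (by positivity)
  have hlog' : 1 / ((n : ℝ) + 1) ≤ log ((n + 1 : ℝ) / n) := by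
    convert hlog using 1
    field_simp
    ring
  have hpow : 1 + z / (n + 1) ≤ ((n + 1 : ℝ) / n) ^ z := by
    rw [rpow_def_of_pos (by positivity)]
    calc 1 + z / (n + 1) ≤ rexp (z / (n + 1)) := by
          linarith [add_one_le_exp (z / ((n : ℝ) + 1))]
      _ ≤ _ := by
          apply exp_le_exp.2
          calc z / ((n : ℝ) + 1) = 1 / ((n : ℝ) + 1) * z := by ring
            _ ≤ _ := mul_le_mul_of_nonneg_right hlog' hz
  have hle : (n : ℝ) ^ z ≤ ((n : ℝ) + 1) ^ z * (((n : ℝ) + 1) / (n + 1 + z)) := by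
    rw [div_rpow (by positivity) hn'.le, le_div_iff₀ (rpow_pos_of_pos hn' z)] at hpow
    rw [mul_div_assoc', le_div_iff₀ (by positivity)]
    calc (n : ℝ) ^ z * (n + 1 + z) = ((1 + z / (n + 1)) * (n : ℝ) ^ z) * (n + 1) := by
          field_simp
      _ ≤ _ := mul_le_mul_of_nonneg_right hpow (by positivity)
  unfold eulerGamma
  rw [prod_range_succ]
  push_cast
  calc _ ≤ (((n : ℝ) + 1) ^ z * (((n : ℝ) + 1) / (n + 1 + z))) *
        ∏ j ∈ range n, ((j : ℝ) + 1) / (j + 1 + z) :=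
        mul_le_mul_of_nonneg_right hle (prod_nonneg fun j _ => by positivity)
    _ = _ := by ring

lemma eulerGamma_mono {m n : ℕ} (hm : 0 < m) (hmn : m ≤ n) {z : ℝ} (hz : 0 ≤ z) :
    eulerGamma m z ≤ eulerGamma n z := by
  induction n, hmn using Nat.le_induction with
  | base => exact le_rfl
  | succ n hmn ih => exact ih.trans (eulerGamma_le_succ (hm.trans_le hmn) hz)

lemma tendsto_eulerGamma {z : ℝ} (hz : 0 ≤ z) :
    Tendsto (fun n => eulerGamma n z) atTop (𝓝 (Gamma (1 + z))) := by
  rcases hz.eq_or_lt with rfl | hz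
  · have h (n : ℕ) : eulerGamma n 0 = 1 := by
      unfold eulerGamma
      rw [rpow_zero, one_mul]
      exact prod_eq_one fun j _ => by rw [add_zero]; exact div_self (by positivity)
    simp [h]
  · rw [add_comm, Gamma_add_one hz.ne']
    refine ((GammaSeq_tendsto_Gamma z).const_mul z).congr fun n => ?_
    rw [GammaSeq, eulerGamma, prod_range_succ', prod_div_distrib]
    have h1 : ∏ j ∈ range n, ((j : ℝ) + 1) = n.factorial := by
      rw [← prod_range_add_one_eq_factorial]
      push_cast
      rfl
    have h2 : ∏ j ∈ range n, (z + ((j + 1 : ℕ) : ℝ)) = ∏ j ∈ range n, ((j : ℝ) + 1 + z) :=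
      prod_congr rfl fun j _ => by push_cast; ring
    have h3 : 0 < ∏ j ∈ range n, ((j : ℝ) + 1 + z) := prod_pos fun j _ => by positivity
    rw [h1, h2, Nat.cast_zero, add_zero]
    field_simp

lemma eulerGamma_natCast_le_factorial {n : ℕ} (hn : 0 < n) (k : ℕ) :
    eulerGamma n k ≤ k.factorial := by
  rw [← Gamma_nat_eq_factorial, add_comm]
  exact ge_of_tendsto (tendsto_eulerGamma k.cast_nonneg)
    ((eventually_ge_atTop n).mono fun m hm => eulerGamma_mono hn hm k.cast_nonneg)

lemma gammaRatio_nonneg {β : ℝ} (hβ : 0 ≤ β) (n k : ℕ) : 0 ≤ gammaRatio β n k :=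
  prod_nonneg fun j _ => by positivity

lemma gammaRatio_le_one {β : ℝ} (hβ : 0 ≤ β) (hβ1 : β ≤ 1) (n k : ℕ) : gammaRatio β n k ≤ 1 := by
  refine prod_le_one (fun j _ => by positivity) fun j _ => ?_
  rw [div_le_one (by positivity)]
  have : β * k ≤ 1 * k := by gcongr
  linarith

lemma rpow_pow_mul_gammaRatio {β : ℝ} (hβ : 0 ≤ β) {n : ℕ} (hn : 0 < n) (k : ℕ) :
    ((n : ℝ) ^ (1 - β)) ^ k * gammaRatio β n k = eulerGamma n k / eulerGamma n (β * k) := by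
  have hn' : (0 : ℝ) < n := by exact_mod_cast hn
  rw [eq_div_iff (eulerGamma_pos hn (by positivity)).ne']
  unfold eulerGamma gammaRatio
  rw [mul_mul_mul_comm, ← prod_mul_distrib, ← rpow_natCast, ← rpow_mul hn'.le,
    ← rpow_add hn']
  congr 1
  · congr 1
    ring
  · exact prod_congr rfl fun j _ => by
      have : 0 ≤ β * k := by positivity
      field_simp

lemma summable_abs_mul_pow {c : ℕ → ℝ} (hc : Summable fun k => |c k|) {x : ℝ}
    (hx : x ∈ Set.Icc (0 : ℝ) 1) : Summable fun k => c k * x ^ k :=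
  Summable.of_norm_bounded hc fun k => by
    rw [norm_mul, norm_pow, norm_eq_abs, norm_eq_abs, abs_of_nonneg hx.1]
    exact mul_le_of_le_one_right (abs_nonneg _) (pow_le_one₀ hx.1 hx.2)

lemma integral_succ_mul_pow (n k : ℕ) :
    ∫ x in (0 : ℝ)..1, ((n : ℝ) + 1) * x ^ n * x ^ k = (n + 1) / (n + 1 + k) := by
  simp_rw [mul_assoc, ← pow_add]
  rw [intervalIntegral.integral_const_mul, integral_pow]
  push_cast
  simp
  ring

lemma hasSum_integral_succ_mul_pow {c : ℕ → ℝ} (hc : Summable fun k => |c k|) (n : ℕ) :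
    HasSum (fun k : ℕ => c k * (((n : ℝ) + 1) / (n + 1 + k)))
      (∫ x in (0 : ℝ)..1, ((n : ℝ) + 1) * x ^ n * ∑' k, c k * x ^ k) := by
  have h : HasSum (fun k : ℕ => ∫ x in (0 : ℝ)..1, ((n : ℝ) + 1) * x ^ n * (c k * x ^ k))
      (∫ x in (0 : ℝ)..1, ((n : ℝ) + 1) * x ^ n * ∑' k, c k * x ^ k) := by
    refine intervalIntegral.hasSum_integral_of_dominated_convergence
      (fun k _ => ((n : ℝ) + 1) * |c k|) (fun k => ?_) (fun k => ?_) ?_ ?_ ?_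
    · exact Continuous.aestronglyMeasurable (by fun_prop)
    · refine ae_of_all _ fun x hx => ?_
      rw [Set.uIoc_of_le zero_le_one] at hx
      rw [norm_mul, norm_mul, norm_mul, norm_pow, norm_pow, norm_eq_abs, norm_eq_abs, norm_eq_abs,
        abs_of_pos hx.1, abs_of_pos (by positivity : (0 : ℝ) < n + 1)]
      have h1 := pow_le_one₀ hx.1.le hx.2 (n := n)
      have h2 := pow_le_one₀ hx.1.le hx.2 (n := k)
      have hx0 := hx.1
      gcongr
      · exact mul_le_of_le_one_right (by positivity) h1
      · exact mul_le_of_le_one_right (abs_nonneg _) h2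
    · exact ae_of_all _ fun x _ => hc.mul_left _
    · exact intervalIntegrable_const
    · refine ae_of_all _ fun x hx => ?_
      rw [Set.uIoc_of_le zero_le_one] at hx
      exact (summable_abs_mul_pow hc ⟨hx.1.le, hx.2⟩).hasSum.mul_left _
  convert h using 2 with k
  rw [← integral_succ_mul_pow, ← intervalIntegral.integral_const_mul]
  congr 1
  ext x
  ring

lemma abs_tsum_mul_ratio_le {β : ℝ} (hβ : 0 ≤ β) (hβ1 : β ≤ 1) {c : ℕ → ℝ}
    (hc : Summable fun k => |c k|) {M : ℝ} {i : ℕ}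
    (h : ∀ x ∈ Set.Ioc (0 : ℝ) 1, |∑' k, c k * x ^ k| ≤ M * x ^ i) (n : ℕ) :
    |∑' k : ℕ, c k * (((n : ℝ) + 1 + β * k) / (n + 1 + k))| ≤
      M * (((n : ℝ) + 1 + β * i) / (n + 1 + i)) := by
  have hI := hasSum_integral_succ_mul_pow hc n
  have hS : HasSum c (∑' k, c k) := (summable_abs_iff.1 hc).hasSum
  have hsplit (k : ℕ) : ((n : ℝ) + 1 + β * k) / (n + 1 + k) =
      β + (1 - β) * ((n + 1) / (n + 1 + k)) := by
    field_simp
    ring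
  have hsum := (hS.mul_left β).add (hI.mul_left (1 - β))
  have heq : ∑' k : ℕ, c k * (((n : ℝ) + 1 + β * k) / (n + 1 + k)) =
      β * ∑' k, c k + (1 - β) * ∫ x in (0 : ℝ)..1, ((n : ℝ) + 1) * x ^ n * ∑' k, c k * x ^ k := by
    rw [← hsum.tsum_eq]
    exact tsum_congr fun k => by rw [hsplit]; ring
  have hint : |∫ x in (0 : ℝ)..1, ((n : ℝ) + 1) * x ^ n * ∑' k, c k * x ^ k| ≤
      M * ((n + 1) / (n + 1 + i)) := by
    rw [← integral_succ_mul_pow, ← intervalIntegral.integral_const_mul, ← norm_eq_abs]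
    refine intervalIntegral.norm_integral_le_of_norm_le zero_le_one (ae_of_all _ fun x hx => ?_)
      (Continuous.intervalIntegrable (by fun_prop) _ _)
    have hx0 := hx.1
    rw [norm_mul, norm_eq_abs, norm_eq_abs, abs_of_pos (by positivity : 0 < ((n : ℝ) + 1) * x ^ n)]
    calc _ ≤ ((n : ℝ) + 1) * x ^ n * (M * x ^ i) := by gcongr; exact h x hx
      _ = _ := by ring
  have h1 : |∑' k, c k| ≤ M := by simpa using h 1 ⟨one_pos, le_rfl⟩
  rw [heq, hsplit]
  have hβ1' : 0 ≤ 1 - β := by linarith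
  calc _ ≤ β * |∑' k, c k| +
        (1 - β) * |∫ x in (0 : ℝ)..1, ((n : ℝ) + 1) * x ^ n * ∑' k, c k * x ^ k| := by
        refine (abs_add_le _ _).trans_eq ?_
        rw [abs_mul, abs_mul, abs_of_nonneg hβ, abs_of_nonneg hβ1']
    _ ≤ β * M + (1 - β) * (M * ((n + 1) / (n + 1 + i))) := by gcongr
    _ = _ := by ring

lemma abs_tsum_mul_gammaRatio_le {β : ℝ} (hβ : 0 ≤ β) (hβ1 : β ≤ 1) {c : ℕ → ℝ}
    (hc : Summable fun k => |c k|) {M : ℝ} {i : ℕ}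
    (h : ∀ x ∈ Set.Ioc (0 : ℝ) 1, |∑' k, c k * x ^ k| ≤ M * x ^ i) (n : ℕ) :
    ∀ x ∈ Set.Ioc (0 : ℝ) 1,
      |∑' k, c k * gammaRatio β n k * x ^ k| ≤ M * gammaRatio β n i * x ^ i := by
  induction n with
  | zero => simpa [gammaRatio] using h
  | succ n ih =>
    intro x hx
    have hx0 := hx.1
    have hc' : Summable fun k => |c k * gammaRatio β n k * x ^ k| :=
      Summable.of_nonneg_of_le (fun _ => abs_nonneg _) (fun k => by
        rw [abs_mul, abs_mul, abs_of_nonneg (gammaRatio_nonneg hβ n k),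
          abs_of_pos (pow_pos hx.1 k), mul_assoc]
        exact mul_le_of_le_one_right (abs_nonneg _)
          (mul_le_one₀ (gammaRatio_le_one hβ hβ1 n k) (by positivity)
            (pow_le_one₀ hx.1.le hx.2))) hc
    have key := abs_tsum_mul_ratio_le hβ hβ1 (M := M * gammaRatio β n i * x ^ i) (i := i) hc'
      (fun y hy => by
        have := ih (x * y) ⟨mul_pos hx.1 hy.1, mul_le_one₀ hx.2 hy.1.le hy.2⟩
        simpa only [mul_pow, mul_assoc] using this) n
    have hsucc (k : ℕ) : gammaRatio β (n + 1) k =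
        gammaRatio β n k * (((n : ℝ) + 1 + β * k) / (n + 1 + k)) := prod_range_succ _ _
    calc _ = |∑' k : ℕ, c k * gammaRatio β n k * x ^ k *
          (((n : ℝ) + 1 + β * k) / (n + 1 + k))| := by
          congr 1
          exact tsum_congr fun k => by rw [hsucc]; ring
      _ ≤ _ := key
      _ = _ := by rw [hsucc]; ring

/-- The exponential series with `k`-th coefficient multiplied by `gammaRatio β n k`. -/
noncomputable def ratioExp (β : ℝ) (n : ℕ) (v : ℝ) : ℝ :=
  ∑' k : ℕ, (-v) ^ k / k.factorial * gammaRatio β n k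

lemma hasSum_pow_div_factorial (x : ℝ) : HasSum (fun k : ℕ => x ^ k / k.factorial) (rexp x) := by
  rw [exp_eq_exp_ℝ]
  exact NormedSpace.expSeries_div_hasSum_exp x

lemma abs_ratioExp_le_one {β : ℝ} (hβ : 0 ≤ β) (hβ1 : β ≤ 1) (n : ℕ) {v : ℝ} (hv : 0 ≤ v) :
    |ratioExp β n v| ≤ 1 := by
  have := abs_tsum_mul_gammaRatio_le hβ hβ1 (c := fun k => (-v) ^ k / k.factorial)
    (summable_abs_iff.2 (hasSum_pow_div_factorial _).summable) (M := 1) (i := 0)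
    (fun x hx => by
      have h : HasSum (fun k : ℕ => (-v) ^ k / k.factorial * x ^ k) (rexp (-v * x)) := by
        convert hasSum_pow_div_factorial (-v * x) using 2 with k
        rw [mul_pow]
        ring
      rw [h.tsum_eq, abs_exp, pow_zero, mul_one, exp_le_one_iff]
      nlinarith [hx.1]) n 1 ⟨one_pos, le_rfl⟩
  simpa [ratioExp] using this.trans (by simpa using gammaRatio_le_one hβ hβ1 n 0)

lemma abs_exp_neg_sub_exp_neg_le {a b : ℝ} (ha : 0 ≤ a) (hb : 0 ≤ b) :
    |rexp (-a) - rexp (-b)| ≤ |a - b| := by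
  wlog hab : a ≤ b generalizing a b
  · rw [abs_sub_comm, abs_sub_comm a]
    exact this hb ha (le_of_not_ge hab)
  rw [abs_of_nonneg (sub_nonneg.2 (exp_le_exp.2 (neg_le_neg hab))), abs_sub_comm,
    abs_of_nonneg (sub_nonneg.2 hab)]
  have h1 : rexp (-b) = rexp (-a) * rexp (a - b) := by rw [← exp_add]; ring_nf
  have h2 := add_one_le_exp (a - b)
  have h3 : rexp (-a) ≤ 1 := exp_le_one_iff.2 (by linarith)
  rw [h1]
  nlinarith [exp_pos (-a)]

lemma abs_ratioExp_sub_le {β : ℝ} (hβ : 0 ≤ β) (hβ1 : β ≤ 1) (n : ℕ) {v w : ℝ} (hv : 0 ≤ v)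
    (hw : 0 ≤ w) : |ratioExp β n v - ratioExp β n w| ≤ |v - w| * gammaRatio β n 1 := by
  have hs (u : ℝ) := (hasSum_pow_div_factorial u).summable
  have hs' (u : ℝ) : Summable fun k : ℕ => (-u) ^ k / k.factorial * gammaRatio β n k :=
    Summable.of_norm_bounded (summable_abs_iff.2 (hs (-u))) fun k => by
      rw [norm_mul, norm_eq_abs, norm_eq_abs, abs_of_nonneg (gammaRatio_nonneg hβ n k)]
      exact mul_le_of_le_one_right (abs_nonneg _) (gammaRatio_le_one hβ hβ1 n k)
  have := abs_tsum_mul_gammaRatio_le hβ hβ1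
    (c := fun k => (-v) ^ k / k.factorial - (-w) ^ k / k.factorial)
    (summable_abs_iff.2 ((hs _).sub (hs _))) (M := |v - w|) (i := 1)
    (fun x hx => by
      have h : HasSum (fun k : ℕ => ((-v) ^ k / k.factorial - (-w) ^ k / k.factorial) * x ^ k)
          (rexp (-(v * x)) - rexp (-(w * x))) := by
        have hterm (k : ℕ) : ((-v) ^ k / k.factorial - (-w) ^ k / k.factorial) * x ^ k =
            (-(v * x)) ^ k / k.factorial - (-(w * x)) ^ k / k.factorial := by
          rw [← neg_mul, ← neg_mul, mul_pow, mul_pow]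
          ring
        simp_rw [hterm]
        exact (hasSum_pow_div_factorial _).sub (hasSum_pow_div_factorial _)
      rw [h.tsum_eq]
      refine (abs_exp_neg_sub_exp_neg_le (mul_nonneg hv hx.1.le)
        (mul_nonneg hw hx.1.le)).trans_eq ?_
      rw [← sub_mul, abs_mul, abs_of_pos hx.1, pow_one]) n 1 ⟨one_pos, le_rfl⟩
  rw [ratioExp, ratioExp, ← (hs' v).tsum_sub (hs' w)]
  simpa [sub_mul] using this

lemma summable_pow_div_eulerGamma {β : ℝ} (hβ : 0 ≤ β) {m : ℕ} (hm : 0 < m) {v : ℝ} (hv : 0 ≤ v)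
    (hvm : v < (m : ℝ) ^ β) : Summable fun k : ℕ => v ^ k / eulerGamma m (β * k) := by
  have hm' : (0 : ℝ) < m := by exact_mod_cast hm
  have hmβ : 0 < (m : ℝ) ^ β := rpow_pos_of_pos hm' β
  set r := v / (m : ℝ) ^ β with hr
  have hr0 : 0 ≤ r := by positivity
  have hr1 : r < 1 := (div_lt_one hmβ).2 hvm
  have hgeom : Summable fun k : ℕ => ((k + 1 : ℕ) : ℝ) ^ m * r ^ (k + 1) :=
    (summable_nat_add_iff 1).2
      (summable_pow_mul_geometric_of_norm_lt_one m (r := r) (by rwa [norm_of_nonneg hr0]))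
  have hpoly : Summable fun k : ℕ => ((1 + β) * (k + 1)) ^ m * r ^ k := by
    rcases hr0.eq_or_lt with h0 | h0
    · rw [← h0]
      refine summable_of_ne_finset_zero (s := {0}) fun k hk => ?_
      rw [zero_pow (by simpa using hk), mul_zero]
    · refine (hgeom.mul_left ((1 + β) ^ m / r)).congr fun k => ?_
      rw [mul_pow, pow_succ r]
      push_cast
      field_simp
  refine Summable.of_nonneg_of_le (fun k => ?_) (fun k => ?_) hpoly
  · exact div_nonneg (by positivity) (eulerGamma_pos hm (by positivity)).le
  · have hprod : (∏ j ∈ range m, ((j : ℝ) + 1) / (j + 1 + β * k))⁻¹ ≤ ((1 + β) * (k + 1)) ^ m := by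
      rw [← prod_inv_distrib]
      refine (prod_le_prod (fun j _ => by positivity) fun j _ => ?_).trans_eq
        (by rw [prod_const, card_range])
      rw [inv_div, div_le_iff₀ (by positivity)]
      have h1 : 0 ≤ β * k := by positivity
      have h2 : 0 ≤ (j : ℝ) := by positivity
      have h3 : (0 : ℝ) ≤ k := by positivity
      nlinarith [mul_nonneg h1 h2, mul_nonneg h3 h2, mul_nonneg hβ h2]
    rw [eulerGamma, rpow_mul hm'.le, rpow_natCast, hr, div_pow, div_eq_mul_inv, mul_inv]
    calc _ = (v ^ k / ((m : ℝ) ^ β) ^ k) *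
          (∏ j ∈ range m, ((j : ℝ) + 1) / (j + 1 + β * k))⁻¹ := by ring
      _ ≤ (v ^ k / ((m : ℝ) ^ β) ^ k) * ((1 + β) * (k + 1)) ^ m := by gcongr
      _ = _ := by ring

lemma tendsto_ratioExp {β : ℝ} (hβ : 0 < β) {v : ℝ} (hv : 0 ≤ v) :
    Tendsto (fun n : ℕ => ratioExp β n ((n : ℝ) ^ (1 - β) * v)) atTop
      (𝓝 (mittagLeffler β (-v))) := by
  obtain ⟨m, hm, hvm⟩ : ∃ m : ℕ, 0 < m ∧ v < (m : ℝ) ^ β :=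
    ((eventually_gt_atTop 0).and (((tendsto_rpow_atTop hβ).comp
      tendsto_natCast_atTop_atTop).eventually_gt_atTop v)).exists
  have hterm {n : ℕ} (hn : 0 < n) (k : ℕ) :
      (-((n : ℝ) ^ (1 - β) * v)) ^ k / k.factorial * gammaRatio β n k =
        (-v) ^ k * (eulerGamma n k / eulerGamma n (β * k)) / k.factorial := by
    rw [← rpow_pow_mul_gammaRatio hβ.le hn, neg_mul_eq_mul_neg, mul_pow]
    ring
  unfold ratioExp mittagLeffler
  refine tendsto_tsum_of_dominated_convergence
    (summable_pow_div_eulerGamma hβ.le hm hv hvm) (fun k => ?_) ?_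
  · have hk : (0 : ℝ) ≤ β * k := by positivity
    have hlim := (((tendsto_eulerGamma k.cast_nonneg).div (tendsto_eulerGamma hk)
      (Gamma_pos_of_pos (by linarith)).ne').const_mul ((-v) ^ k)).div_const (k.factorial : ℝ)
    have heq : (-v) ^ k * (Gamma (1 + k) / Gamma (1 + β * k)) / k.factorial =
        (-v) ^ k / Gamma (1 + β * k) := by
      rw [add_comm, Gamma_nat_eq_factorial]
      field_simp
    rw [heq] at hlim
    exact hlim.congr' ((eventually_gt_atTop 0).mono fun n hn => (hterm hn k).symm)
  · filter_upwards [eventually_ge_atTop m] with n hn k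
    have hn0 := hm.trans_le hn
    have hk : (0 : ℝ) ≤ β * k := by positivity
    have h1 := eulerGamma_pos hm hk
    have h2 := eulerGamma_mono hm hn hk
    have h3 := eulerGamma_natCast_le_factorial hn0 k
    have h4 := eulerGamma_pos hn0 (k.cast_nonneg (α := ℝ))
    have h5 := eulerGamma_pos hn0 hk
    rw [hterm hn0, norm_div, norm_mul, norm_pow, norm_neg, norm_of_nonneg hv,
      norm_of_nonneg (div_pos h4 h5).le, norm_of_nonneg (by positivity), div_le_iff₀ (by positivity)]
    calc v ^ k * (eulerGamma n k / eulerGamma n (β * k))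
        ≤ v ^ k * (k.factorial / eulerGamma m (β * k)) := by gcongr
      _ = _ := by ring

lemma abs_mittagLeffler_neg_le_one {β : ℝ} (hβ : 0 < β) (hβ1 : β ≤ 1) {v : ℝ} (hv : 0 ≤ v) :
    |mittagLeffler β (-v)| ≤ 1 :=
  le_of_tendsto (tendsto_ratioExp hβ hv).abs <| Eventually.of_forall fun n =>
    abs_ratioExp_le_one hβ.le hβ1 n (by positivity)

lemma abs_mittagLeffler_neg_sub_le {β : ℝ} (hβ : 0 < β) (hβ1 : β ≤ 1) {v w : ℝ} (hv : 0 ≤ v)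
    (hw : 0 ≤ w) : |mittagLeffler β (-v) - mittagLeffler β (-w)| ≤ (1 + β) * |v - w| := by
  refine le_of_tendsto ((tendsto_ratioExp hβ hv).sub (tendsto_ratioExp hβ hw)).abs ?_
  filter_upwards [eventually_gt_atTop 0] with n hn
  have hn' : (0 : ℝ) < n := by exact_mod_cast hn
  have hpow : 0 < (n : ℝ) ^ (1 - β) := rpow_pos_of_pos hn' _
  have hratio : (n : ℝ) ^ (1 - β) * gammaRatio β n 1 ≤ 1 + β := by
    have h := rpow_pow_mul_gammaRatio hβ.le hn 1
    rw [pow_one, Nat.cast_one, mul_one] at h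
    have h1 := eulerGamma_natCast_le_factorial hn 1
    have h2 := eulerGamma_mono one_pos hn hβ.le
    have h3 : eulerGamma 1 β = (1 + β)⁻¹ := by simp [eulerGamma]
    rw [h3] at h2
    rw [h, div_le_iff₀ (eulerGamma_pos hn hβ.le)]
    calc _ ≤ (1 : ℝ) := by simpa using h1
      _ = (1 + β) * (1 + β)⁻¹ := by field_simp
      _ ≤ _ := by gcongr
  calc _ ≤ |(n : ℝ) ^ (1 - β) * v - (n : ℝ) ^ (1 - β) * w| * gammaRatio β n 1 :=
        abs_ratioExp_sub_le hβ.le hβ1 n (by positivity) (by positivity)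
    _ = ((n : ℝ) ^ (1 - β) * gammaRatio β n 1) * |v - w| := by
        rw [← mul_sub, abs_mul, abs_of_pos hpow]
        ring
    _ ≤ _ := by gcongr

lemma abs_rpow_sub_rpow_le {β : ℝ} (hβ : 0 ≤ β) (hβ1 : β ≤ 1) {t s : ℝ} (ht : 0 ≤ t) (hs : 0 ≤ s) :
    |t ^ β - s ^ β| ≤ |t - s| ^ β := by
  wlog hst : s ≤ t generalizing t s
  · rw [abs_sub_comm, abs_sub_comm t]
    exact this hs ht (le_of_not_ge hst)
  rw [abs_of_nonneg (sub_nonneg.2 (rpow_le_rpow hs hst hβ)), abs_of_nonneg (sub_nonneg.2 hst)]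
  have := rpow_add_le_add_rpow (sub_nonneg.2 hst) hs hβ hβ1
  rw [sub_add_cancel] at this
  linarith

lemma le_rpow_mul_rpow_of_le {d A B η : ℝ} (hd : 0 ≤ d) (hA : d ≤ A) (hB : d ≤ B)
    (hη : 0 ≤ η) (hη1 : η ≤ 1) : d ≤ A ^ (1 - η) * B ^ η :=
  calc d = d ^ (1 - η) * d ^ η := by
        rw [← rpow_add_of_nonneg hd (by linarith) hη, sub_add_cancel, rpow_one]
    _ ≤ _ := mul_le_mul (rpow_le_rpow hd hA (by linarith)) (rpow_le_rpow hd hB hη)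
        (rpow_nonneg hd _) (rpow_nonneg (hd.trans hA) _)

/-- Hölder-type estimate for differences of the Mittag-Leffler factor:
`|E_β(-μt^β|λ|^α) - E_β(-μs^β|λ|^α)| ≤ C |λ|^{ηα} |t-s|^{ηβ}`. -/
theorem mittagLeffler_holder_estimate
    (β μ α η : ℝ) (hβ : β ∈ Set.Ioo (0 : ℝ) 1) (hμ : 0 < μ) (hα : 0 ≤ α)
    (hη : η ∈ Set.Ioc (0 : ℝ) 1) :
    ∃ C : ℝ, 0 < C ∧ ∀ l : ℝ, ∀ t s : ℝ, 0 < t → 0 < s →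
      |mittagLeffler β (-(μ * t ^ β * |l| ^ α)) -
          mittagLeffler β (-(μ * s ^ β * |l| ^ α))| ≤
        C * |l| ^ (η * α) * |t - s| ^ (η * β) := by
  obtain ⟨hβ0, hβ1⟩ := hβ
  refine ⟨2 ^ (1 - η) * ((1 + β) * μ) ^ η, by positivity, fun l t s ht hs => ?_⟩
  set x := |l| ^ α with hx
  have hx0 : 0 ≤ x := by positivity
  have hv : 0 ≤ μ * t ^ β * x := by positivity
  have hw : 0 ≤ μ * s ^ β * x := by positivity
  have hbdd : |mittagLeffler β (-(μ * t ^ β * x)) - mittagLeffler β (-(μ * s ^ β * x))| ≤ 2 := by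
    linarith [abs_sub (mittagLeffler β (-(μ * t ^ β * x))) (mittagLeffler β (-(μ * s ^ β * x))),
      abs_mittagLeffler_neg_le_one hβ0 hβ1.le hv, abs_mittagLeffler_neg_le_one hβ0 hβ1.le hw]
  have hlip : |mittagLeffler β (-(μ * t ^ β * x)) - mittagLeffler β (-(μ * s ^ β * x))| ≤
      ((1 + β) * μ) * (x * |t - s| ^ β) := by
    refine (abs_mittagLeffler_neg_sub_le hβ0 hβ1.le hv hw).trans ?_
    rw [← sub_mul, ← mul_sub, abs_mul, abs_mul, abs_of_pos hμ, abs_of_nonneg hx0]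
    calc _ = ((1 + β) * μ) * (x * |t ^ β - s ^ β|) := by ring
      _ ≤ _ := by
        gcongr
        exact abs_rpow_sub_rpow_le hβ0.le hβ1.le ht.le hs.le
  refine (le_rpow_mul_rpow_of_le (abs_nonneg _) hbdd hlip hη.1.le hη.2).trans_eq ?_
  rw [mul_rpow (by positivity) (by positivity), mul_rpow hx0 (by positivity), hx,
    ← rpow_mul (abs_nonneg l), ← rpow_mul (abs_nonneg (t - s)), mul_comm α, mul_comm β η]
  ring
end
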